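/- arXiv:1203.4786 — 3 statements merged into one kernel-verified Lean document; each statement's English description precedes it below -/
import Mathlib

section
/- Let (Ω, F, μ) be a probability space, ũ ∈ S_d^{--}, and let Σ_T : Ω → (d×d real matrices) be measurable with Σ_T(ω) symmetric positive definite for μ-a.e. ω, such that exp(−trace(ũ·Σ_T)) is μ-integrable. Let N ≥ 2 and let b_1 > b_2 > ... > b_{N−1} > 1 be real numbers with ∫_Ω exp(−trace(ũ·Σ_T)) dμ > b_1. Then there exist real numbers 0 < ξ_{N−1} < ξ_{N−2} < ... < ξ_1 < 1 such that ∫_Ω exp(−ξ_k·trace(ũ·Σ_T)) dμ = b_k for every k ∈ {1, ..., N−1}. Consequently, setting u_k := ξ_k·ũ (k = 1, ..., N−1) and u_N := 0 yields a strictly increasing sequence u_1 ≺ u_2 ≺ ... ≺ u_{N−1} ≺ 0 of matrices in S_d^{--} (i.e., u_k − u_{k+1} is negative definite) whose Laplace-transform values fit the prescribed sequence b_1, ..., b_{N−1}, 1. -/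
open Matrix MeasureTheory

open scoped MatrixOrder Matrix.Norms.L2Operator in
theorem Matrix.PosSemidef.trace_mul_nonneg {n : Type*} [Fintype n] [DecidableEq n]
    {A B : Matrix n n ℝ} (hA : A.PosSemidef) (hB : B.PosSemidef) : 0 ≤ (A * B).trace := by
  obtain ⟨C, rfl⟩ := CStarAlgebra.nonneg_iff_eq_star_mul_self.mp hA.nonneg
  rw [Matrix.mul_assoc, Matrix.trace_mul_comm]
  exact (hB.mul_mul_conjTranspose_same C).trace_nonneg

section ExponentialMoment

variable {Ω : Type*} {F : MeasurableSpace Ω} {μ : Measure Ω} {Y : Ω → ℝ}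

theorem integrable_exp_mul_of_mem_Icc (hY : AEStronglyMeasurable Y μ)
    (hY0 : ∀ᵐ ω ∂μ, 0 ≤ Y ω) (hint : Integrable (fun ω => Real.exp (Y ω)) μ)
    {t : ℝ} (ht : t ∈ Set.Icc (0 : ℝ) 1) : Integrable (fun ω => Real.exp (t * Y ω)) μ := by
  refine hint.mono (Real.continuous_exp.comp_aestronglyMeasurable (hY.const_mul t)) ?_
  filter_upwards [hY0] with ω h
  rw [Real.norm_of_nonneg (Real.exp_pos _).le, Real.norm_of_nonneg (Real.exp_pos _).le]
  exact Real.exp_le_exp.mpr (mul_le_of_le_one_left h ht.2)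

theorem monotoneOn_integral_exp_mul (hY : AEStronglyMeasurable Y μ)
    (hY0 : ∀ᵐ ω ∂μ, 0 ≤ Y ω) (hint : Integrable (fun ω => Real.exp (Y ω)) μ) :
    MonotoneOn (fun t : ℝ => ∫ ω, Real.exp (t * Y ω) ∂μ) (Set.Icc 0 1) := by
  intro s hs t ht hst
  refine integral_mono_ae (integrable_exp_mul_of_mem_Icc hY hY0 hint hs)
    (integrable_exp_mul_of_mem_Icc hY hY0 hint ht) ?_
  filter_upwards [hY0] with ω h
  exact Real.exp_le_exp.mpr (mul_le_mul_of_nonneg_right hst h)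

theorem continuousOn_integral_exp_mul (hY : AEStronglyMeasurable Y μ)
    (hY0 : ∀ᵐ ω ∂μ, 0 ≤ Y ω) (hint : Integrable (fun ω => Real.exp (Y ω)) μ) :
    ContinuousOn (fun t : ℝ => ∫ ω, Real.exp (t * Y ω) ∂μ) (Set.Icc 0 1) := by
  refine continuousOn_of_dominated (bound := fun ω => Real.exp (Y ω))
    (fun t _ => Real.continuous_exp.comp_aestronglyMeasurable (hY.const_mul t)) ?_ hint ?_
  · intro t ht
    filter_upwards [hY0] with ω h
    rw [Real.norm_of_nonneg (Real.exp_pos _).le]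
    exact Real.exp_le_exp.mpr (mul_le_of_le_one_left h ht.2)
  · exact Filter.Eventually.of_forall fun ω => by fun_prop

end ExponentialMoment

theorem Matrix.PosDef.neg_smul_of_pos {n : Type*} {u : Matrix n n ℝ}
    (hu : (-u).PosDef) {c : ℝ} (hc : 0 < c) : (-(c • u)).PosDef := by
  rw [← smul_neg]
  exact hu.smul hc

open Matrix MeasureTheory

/-- **existence part of Proposition 3.3.** Let `(Ω, F, μ)` be a probability
space, `ũ ∈ S_d^{--}`, `X = Σ_T` measurable with symmetric positive definite values a.e.
and `exp (-trace (ũ * X))` integrable.  Let `N ≥ 2` and `b 0 > b 1 > ... > b (N-2) > 1`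
(indexed by `Fin (N-1)`, so `b k` plays the role of `b_{k+1}` in the paper) with
`∫ exp (-trace (ũ * X)) dμ > b 0`.  Then there are `0 < ξ_{N-1} < ... < ξ_1 < 1`
(a strictly decreasing `ξ : Fin (N-1) → ℝ`) such that
`∫ exp (-ξ_k * trace (ũ * X)) dμ = b k` for each `k`; consequently the matrices
`u_k := ξ_k • ũ` (and `u_N := 0`) form a strictly increasing chain
`u_1 ≺ u_2 ≺ ... ≺ u_{N-1} ≺ 0` in `S_d^{--}`. -/
theorem fit_initial_term_structure {Ω : Type*} {F : MeasurableSpace Ω}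
    {μ : Measure Ω} [IsProbabilityMeasure μ]
    {d : ℕ} (hd : 0 < d)
    (u : Matrix (Fin d) (Fin d) ℝ) (hu_symm : u.IsSymm) (hu : (-u).PosDef)
    (X : Ω → Matrix (Fin d) (Fin d) ℝ) (hmeas : StronglyMeasurable X)
    (hpos : ∀ᵐ ω ∂μ, (X ω).IsSymm ∧ (X ω).PosDef)
    (hint : Integrable (fun ω => Real.exp (-(u * X ω).trace)) μ)
    {N : ℕ} (hN : 2 ≤ N) (b : Fin (N - 1) → ℝ)
    (hb_anti : StrictAnti b) (hb_one : ∀ k, 1 < b k)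
    (hb_big : b ⟨0, by omega⟩ < ∫ ω, Real.exp (-(u * X ω).trace) ∂μ) :
    ∃ ξ : Fin (N - 1) → ℝ,
      (∀ k, 0 < ξ k ∧ ξ k < 1) ∧ StrictAnti ξ ∧
      (∀ k, (∫ ω, Real.exp (-(ξ k * (u * X ω).trace)) ∂μ) = b k) ∧
      (∀ k, (-(ξ k • u)).PosDef) ∧
      (∀ j k : Fin (N - 1), j < k → (-(ξ j • u - ξ k • u)).PosDef) := by
  have htrace : AEStronglyMeasurable (fun ω => -(u * X ω).trace) μ := by
    have h : Continuous fun A : Matrix (Fin d) (Fin d) ℝ => -(u * A).trace := by fun_prop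
    exact (h.comp_stronglyMeasurable hmeas).aestronglyMeasurable
  have hnonneg : ∀ᵐ ω ∂μ, 0 ≤ -(u * X ω).trace := by
    filter_upwards [hpos] with ω h
    have := hu.posSemidef.trace_mul_nonneg h.2.posSemidef
    rwa [Matrix.neg_mul, Matrix.trace_neg] at this
  have hmono := monotoneOn_integral_exp_mul htrace hnonneg hint
  have hcont := continuousOn_integral_exp_mul htrace hnonneg hint
  have hsol : ∀ k, ∃ t ∈ Set.Ioo (0 : ℝ) 1,
      ∫ ω, Real.exp (t * -(u * X ω).trace) ∂μ = b k := by
    intro k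
    have hk : b k ≤ b ⟨0, by omega⟩ := hb_anti.antitone (Fin.mk_le_of_le_val (Nat.zero_le _))
    apply intermediate_value_Ioo zero_le_one hcont
    constructor
    · simpa using hb_one k
    · simpa using hk.trans_lt hb_big
  choose ξ hξ hval using hsol
  have hanti : StrictAnti ξ := by
    intro j k hjk
    by_contra! hle
    have h := hmono (Set.Ioo_subset_Icc_self (hξ j)) (Set.Ioo_subset_Icc_self (hξ k)) hle
    simp only [hval] at h
    exact absurd (hb_anti hjk) h.not_gt
  refine ⟨ξ, hξ, hanti, fun k => ?_, fun k => hu.neg_smul_of_pos (hξ k).1, fun j k hjk => ?_⟩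
  · simpa only [mul_neg] using hval k
  · rw [← sub_smul]
    exact hu.neg_smul_of_pos (sub_pos.mpr (hanti hjk))
end

section
/- Let B and Σ be d×d real symmetric positive semidefinite matrices and let Q be any d×d real matrix. Then trace(B·QᵀQ·B·QᵀQ·B·Σ) ≥ 0. If moreover Σ is positive definite, Q is invertible and B ≠ 0, then trace(Q·B·Σ·B·Qᵀ) > 0 and trace(Σ·B·QᵀQ·B·QᵀQ·B·QᵀQ·B) > 0, so that the quantity trace(B·QᵀQ·B·QᵀQ·B·Σ) / ( sqrt(trace(Q·B·Σ·B·Qᵀ)) · sqrt(trace(Σ·B·QᵀQ·B·QᵀQ·B·QᵀQ·B)) ) is well defined and nonnegative. -/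
open Matrix

open scoped ComplexOrder MatrixOrder in
/-- The trace pairing of two positive semidefinite matrices is nonnegative. -/
lemma Matrix.PosSemidef.trace_mul_nonneg_s10 {n : Type*} [Fintype n] [DecidableEq n]
    {P S : Matrix n n ℝ} (hP : P.PosSemidef) (hS : S.PosSemidef) : 0 ≤ (P * S).trace := by
  obtain ⟨X, rfl⟩ := CStarAlgebra.nonneg_iff_eq_star_mul_self.mp hS.nonneg
  rw [← Matrix.mul_assoc, Matrix.trace_mul_comm, ← Matrix.mul_assoc]
  exact (hP.mul_mul_conjTranspose_same X).trace_nonneg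

open scoped ComplexOrder MatrixOrder in
/-- The trace pairing of a nonzero positive semidefinite matrix with a positive definite one
is positive. -/
lemma Matrix.PosDef.trace_conjTranspose_mul_self_mul_pos {n : Type*} [Fintype n] [DecidableEq n]
    {S : Matrix n n ℝ} (hS : S.PosDef) {Y : Matrix n n ℝ} (hY : Y ≠ 0) :
    0 < (Yᴴ * Y * S).trace := by
  obtain ⟨X, hX⟩ := CStarAlgebra.nonneg_iff_eq_star_mul_self.mp hS.posSemidef.nonneg
  have hXu : IsUnit Xᴴ := by
    have h := hS.isUnit
    rw [hX, Matrix.isUnit_iff_isUnit_det, Matrix.det_mul, IsUnit.mul_iff] at h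
    exact (Matrix.isUnit_iff_isUnit_det _).2 h.1
  refine lt_of_le_of_ne
    ((posSemidef_conjTranspose_mul_self Y).trace_mul_nonneg_s10 hS.posSemidef) fun h0 => hY ?_
  have h1 : ((Y * Xᴴ)ᴴ * (Y * Xᴴ)).trace = 0 := by
    rw [h0, hX, ← Matrix.mul_assoc (Yᴴ * Y), Matrix.trace_mul_comm _ X]
    simp only [conjTranspose_mul, conjTranspose_conjTranspose, Matrix.mul_assoc,
      star_eq_conjTranspose]
  exact hXu.mul_left_eq_zero.mp (trace_conjTranspose_mul_self_eq_zero_iff.mp h1)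

/-- **deterministic content of Proposition 5.1: positivity of the skew.**
For `B, S` real symmetric positive semidefinite and any `Q`,
`trace (B QᵀQ B QᵀQ B S) ≥ 0`.  If moreover `S` is positive definite, `Q` is invertible
and `B ≠ 0`, then `trace (Q B S B Qᵀ) > 0` and
`trace (S B QᵀQ B QᵀQ B QᵀQ B) > 0`, so the normalized skew
`trace (B QᵀQ B QᵀQ B S) / (√trace(Q B S B Qᵀ) · √trace(S B QᵀQ B QᵀQ B QᵀQ B))`
is well defined and nonnegative. -/
theorem wishart_skew_nonneg {d : ℕ} (B S Q : Matrix (Fin d) (Fin d) ℝ)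
    (hB : B.PosSemidef) (hS : S.PosSemidef) :
    0 ≤ (B * (Qᵀ * Q) * B * (Qᵀ * Q) * B * S).trace ∧
    (S.PosDef → IsUnit Q → B ≠ 0 →
      0 < (Q * B * S * B * Qᵀ).trace ∧
      0 < (S * B * (Qᵀ * Q) * B * (Qᵀ * Q) * B * (Qᵀ * Q) * B).trace ∧
      0 ≤ (B * (Qᵀ * Q) * B * (Qᵀ * Q) * B * S).trace /
        (Real.sqrt (Q * B * S * B * Qᵀ).trace *
          Real.sqrt (S * B * (Qᵀ * Q) * B * (Qᵀ * Q) * B * (Qᵀ * Q) * B).trace)) := by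
  have hBt : Bᵀ = B := by simpa using hB.1.eq
  have hnonneg : 0 ≤ (B * (Qᵀ * Q) * B * (Qᵀ * Q) * B * S).trace := by
    have h := (hB.mul_mul_conjTranspose_same (B * (Qᵀ * Q))).trace_mul_nonneg_s10 hS
    simpa [Matrix.mul_assoc, transpose_mul, hBt, conjTranspose_eq_transpose_of_trivial] using h
  refine ⟨hnonneg, fun hSd hQ hB0 => ?_⟩
  have hQB : Q * B ≠ 0 := fun h => hB0 (hQ.mul_right_eq_zero.mp h)
  have hQBQB : Q * (B * (Qᵀ * Q) * B) ≠ 0 := by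
    intro h
    refine hQB (conjTranspose_mul_self_eq_zero.mp ?_)
    simpa [Matrix.mul_assoc, transpose_mul, hBt, conjTranspose_eq_transpose_of_trivial]
      using hQ.mul_right_eq_zero.mp h
  refine ⟨?_, ?_, by positivity⟩
  · have h := hSd.trace_conjTranspose_mul_self_mul_pos hQB
    rw [Matrix.mul_assoc, Matrix.trace_mul_comm] at h
    simpa only [Matrix.mul_assoc, transpose_mul, hBt,
      conjTranspose_eq_transpose_of_trivial] using h
  · have h := hSd.trace_conjTranspose_mul_self_mul_pos hQBQB
    rw [Matrix.trace_mul_comm] at h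
    simpa only [Matrix.mul_assoc, transpose_mul, transpose_transpose, hBt,
      conjTranspose_eq_transpose_of_trivial] using h
end

section
/- Let (Ω, F, μ) be a probability space, Y : Ω → ℝ a random variable, α > 0, K > 0, and set c := log K. Assume that exp((1+α)·Y) is μ-integrable. Then: (i) the complex-valued function v ↦ e^{−ivc} · E[e^{(α+1+iv)Y}] / ((α+iv)(1+α+iv)) is integrable over ℝ (where E denotes expectation under μ and i the imaginary unit), and (ii) the expected payoff satisfies E[(e^Y − K)⁺] = (e^{−αc} / (2π)) · ∫_{−∞}^{+∞} Re( e^{−ivc} · E[e^{(α+1+iv)Y}] / ((α+iv)(1+α+iv)) ) dv. -/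
open MeasureTheory

open scoped FourierTransform

/-- The Fourier kernel of the damped call payoff. -/
noncomputable def callKernel (α v : ℝ) : ℂ :=
  (((α : ℂ) + (v : ℂ) * Complex.I) * (1 + (α : ℂ) + (v : ℂ) * Complex.I))⁻¹

/-- The damped payoff, as a function of the log-moneyness. -/
noncomputable def dampedCall (α s : ℝ) : ℝ :=
  Real.exp (-(1 + α) * s) * max (Real.exp s - 1) 0

lemma add_mul_I_ne_zero {a : ℝ} (ha : 0 < a) (v : ℝ) : (a : ℂ) + (v : ℂ) * Complex.I ≠ 0 := by
  intro h
  have := congrArg Complex.re h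
  simp at this
  exact ha.ne' this

lemma continuous_callKernel {α : ℝ} (hα : 0 < α) : Continuous (callKernel α) := by
  unfold callKernel
  refine Continuous.inv₀ (by fun_prop) fun v => mul_ne_zero (add_mul_I_ne_zero hα v) ?_
  simpa using add_mul_I_ne_zero (a := 1 + α) (by linarith) v

lemma integrable_callKernel {α : ℝ} (hα : 0 < α) : Integrable (callKernel α) := by
  have hdom : Integrable fun v : ℝ => (α ^ 2)⁻¹ * (1 + (v * α⁻¹) ^ 2)⁻¹ :=
    (integrable_inv_one_add_sq.comp_mul_right' (inv_ne_zero hα.ne')).const_mul _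
  refine hdom.mono' (continuous_callKernel hα).aestronglyMeasurable (.of_forall fun v => ?_)
  have h₁ : ‖(α : ℂ) + (v : ℂ) * Complex.I‖ = √(α ^ 2 + v ^ 2) := Complex.norm_add_mul_I α v
  have h₂ : ‖1 + (α : ℂ) + (v : ℂ) * Complex.I‖ = √((1 + α) ^ 2 + v ^ 2) := by
    simpa using Complex.norm_add_mul_I (1 + α) v
  have h₃ : √(α ^ 2 + v ^ 2) ≤ √((1 + α) ^ 2 + v ^ 2) := by gcongr; linarith
  have h₄ : α ^ 2 * (1 + (v * α⁻¹) ^ 2) = α ^ 2 + v ^ 2 := by field_simp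
  have h₅ : α ^ 2 + v ^ 2 = √(α ^ 2 + v ^ 2) * √(α ^ 2 + v ^ 2) :=
    (Real.mul_self_sqrt (by positivity)).symm
  rw [callKernel, norm_inv, norm_mul, h₁, h₂, ← mul_inv, h₄]
  refine inv_anti₀ (by positivity) ?_
  calc α ^ 2 + v ^ 2 = √(α ^ 2 + v ^ 2) * √(α ^ 2 + v ^ 2) := h₅
    _ ≤ √(α ^ 2 + v ^ 2) * √((1 + α) ^ 2 + v ^ 2) := by gcongr

lemma continuous_dampedCall (α : ℝ) : Continuous (dampedCall α) := by
  unfold dampedCall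
  fun_prop

lemma dampedCall_eq_indicator (α : ℝ) :
    dampedCall α = (Set.Ioi 0).indicator
      fun s => Real.exp (-α * s) - Real.exp (-(1 + α) * s) := by
  ext s
  rcases le_or_gt s 0 with hs | hs
  · rw [Set.indicator_of_notMem (by simpa using hs), dampedCall,
      max_eq_right (by simpa using hs), mul_zero]
  · rw [Set.indicator_of_mem (by simpa using hs), dampedCall,
      max_eq_left (by simpa using hs.le), mul_sub, ← Real.exp_add, mul_one]
    ring_nf

lemma integrable_dampedCall {α : ℝ} (hα : 0 < α) : Integrable (dampedCall α) := by
  rw [dampedCall_eq_indicator, integrable_indicator_iff measurableSet_Ioi]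
  exact (integrableOn_exp_mul_Ioi (by linarith) 0).sub (integrableOn_exp_mul_Ioi (by linarith) 0)

lemma fourier_dampedCall {α : ℝ} (hα : 0 < α) (w : ℝ) :
    𝓕 (fun s : ℝ => (dampedCall α s : ℂ)) w = callKernel α (2 * Real.pi * w) := by
  set v : ℝ := 2 * Real.pi * w with hv
  have hre₁ : (-((α : ℂ) + (v : ℂ) * Complex.I)).re < 0 := by simpa using hα
  have hre₂ : (-(1 + (α : ℂ) + (v : ℂ) * Complex.I)).re < 0 := by simp; linarith
  have hne₁ := add_mul_I_ne_zero hα v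
  have hne₂ : 1 + (α : ℂ) + (v : ℂ) * Complex.I ≠ 0 := by
    simpa using add_mul_I_ne_zero (a := 1 + α) (by linarith) v
  have hfun : (fun s : ℝ => Complex.exp (((-2 * Real.pi * s * w : ℝ) : ℂ) * Complex.I) •
      (dampedCall α s : ℂ)) = (Set.Ioi (0 : ℝ)).indicator fun s : ℝ =>
        Complex.exp (-((α : ℂ) + (v : ℂ) * Complex.I) * s) -
          Complex.exp (-(1 + (α : ℂ) + (v : ℂ) * Complex.I) * s) := by
    ext s
    rw [dampedCall_eq_indicator]
    by_cases hs : s ∈ Set.Ioi (0 : ℝ)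
    · simp only [Set.indicator_of_mem hs, smul_eq_mul, hv]
      push_cast
      rw [mul_sub, ← Complex.exp_add, ← Complex.exp_add]
      ring_nf
    · simp [Set.indicator_of_notMem hs]
  rw [Real.fourier_real_eq_integral_exp_smul, hfun, integral_indicator measurableSet_Ioi,
    integral_sub (integrableOn_exp_mul_complex_Ioi hre₁ 0)
      (integrableOn_exp_mul_complex_Ioi hre₂ 0),
    integral_exp_mul_complex_Ioi hre₁, integral_exp_mul_complex_Ioi hre₂, callKernel]
  simp only [Complex.ofReal_zero, mul_zero, Complex.exp_zero]
  rw [neg_div_neg_eq, neg_div_neg_eq]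
  field_simp
  ring

lemma integral_exp_mul_callKernel {α : ℝ} (hα : 0 < α) (s : ℝ) :
    ∫ v : ℝ, Complex.exp ((v * s : ℝ) * Complex.I) * callKernel α v =
      2 * Real.pi * dampedCall α s := by
  have hF : 𝓕 (fun s : ℝ => (dampedCall α s : ℂ)) =
      fun w => callKernel α (2 * Real.pi * w) := funext (fourier_dampedCall hα)
  have hpi : (2 * Real.pi : ℝ) ≠ 0 := by positivity
  have hinv := Continuous.fourierInv_fourier_eq
    (Complex.continuous_ofReal.comp (continuous_dampedCall α)) (integrable_dampedCall hα).ofReal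
    (by
      change Integrable (𝓕 (fun s : ℝ => (dampedCall α s : ℂ)))
      rw [hF]
      exact (integrable_callKernel hα).comp_mul_left' hpi)
  have hs := congrFun hinv s
  change 𝓕⁻ (𝓕 (fun s : ℝ => (dampedCall α s : ℂ))) s = dampedCall α s at hs
  rw [hF, Real.fourierInv_eq'] at hs
  have hscale := Measure.integral_comp_mul_left
    (fun v : ℝ => Complex.exp ((v * s : ℝ) * Complex.I) * callKernel α v) (2 * Real.pi)
  have hcongr : ∫ w : ℝ, Complex.exp (((2 * Real.pi * w * s : ℝ) : ℂ) * Complex.I) *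
      callKernel α (2 * Real.pi * w) = dampedCall α s := by
    rw [← hs]
    refine integral_congr_ae (.of_forall fun w => ?_)
    simp [mul_assoc, mul_comm w s]
  rw [hcongr, abs_of_pos (by positivity), Complex.real_smul] at hscale
  have hpi' : (2 * Real.pi : ℂ) ≠ 0 := by exact_mod_cast hpi
  rw [hscale, Complex.ofReal_inv, Complex.ofReal_mul, Complex.ofReal_ofNat,
    mul_inv_cancel_left₀ hpi']

lemma exp_mul_dampedCall {α K : ℝ} (hK : 0 < K) (y : ℝ) :
    Real.exp ((1 + α) * y) * dampedCall α (y - Real.log K) =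
      Real.exp (α * Real.log K) * max (Real.exp y - K) 0 := by
  have hmax : max (Real.exp y - K) 0 = K * max (Real.exp (y - Real.log K) - 1) 0 := by
    rw [mul_max_of_nonneg _ _ hK.le, Real.exp_sub, Real.exp_log hK, mul_zero]
    congr 1
    field_simp
  rw [hmax, dampedCall, ← mul_assoc, ← mul_assoc, ← Real.exp_add]
  congr 1
  nth_rw 3 [← Real.exp_log hK]
  rw [← Real.exp_add]
  ring_nf

/-- **Carr–Madan Fourier pricing with damping `α`.** Let `Y` be a real
random variable on a probability space, `α > 0`, `K > 0`, `c := log K`, and assume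
`exp ((1+α) Y)` is integrable.  Then the damped Fourier integrand
`v ↦ e^{-ivc} E[e^{(α+1+iv) Y}] / ((α+iv)(1+α+iv))` is integrable over `ℝ` and
`E[(e^Y - K)⁺] = (e^{-αc}/(2π)) ∫_ℝ Re(e^{-ivc} E[e^{(α+1+iv)Y}]/((α+iv)(1+α+iv))) dv`. -/
theorem carr_madan_formula {Ω : Type*} {F : MeasurableSpace Ω}
    {μ : Measure Ω} [IsProbabilityMeasure μ]
    (Y : Ω → ℝ) (hY : Measurable Y) (α K : ℝ) (hα : 0 < α) (hK : 0 < K)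
    (hint : Integrable (fun ω => Real.exp ((1 + α) * Y ω)) μ) :
    Integrable (fun v : ℝ =>
      Complex.exp (-((v * Real.log K : ℝ) : ℂ) * Complex.I) *
          (∫ ω, Complex.exp (((α : ℂ) + 1 + (v : ℂ) * Complex.I) * (Y ω : ℂ)) ∂μ) /
        (((α : ℂ) + (v : ℂ) * Complex.I) * (1 + (α : ℂ) + (v : ℂ) * Complex.I)))
      volume ∧
    ∫ ω, max (Real.exp (Y ω) - K) 0 ∂μ =
      Real.exp (-α * Real.log K) / (2 * Real.pi) *
        ∫ v : ℝ,
          (Complex.exp (-((v * Real.log K : ℝ) : ℂ) * Complex.I) *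
              (∫ ω, Complex.exp (((α : ℂ) + 1 + (v : ℂ) * Complex.I) * (Y ω : ℂ)) ∂μ) /
            (((α : ℂ) + (v : ℂ) * Complex.I) *
              (1 + (α : ℂ) + (v : ℂ) * Complex.I))).re := by
  set c := Real.log K with hc
  let G : ℝ → Ω → ℂ := fun v ω => Complex.exp (-((v * c : ℝ) : ℂ) * Complex.I) *
    Complex.exp (((α : ℂ) + 1 + (v : ℂ) * Complex.I) * (Y ω : ℂ)) * callKernel α v
  have hGeq : ∀ v ω, G v ω = (Real.exp ((1 + α) * Y ω) : ℂ) *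
      (Complex.exp ((v * (Y ω - c) : ℝ) * Complex.I) * callKernel α v) := fun v ω => by
    simp only [G, ← mul_assoc]
    push_cast
    rw [← Complex.exp_add, ← Complex.exp_add]
    ring_nf
  have hG : Integrable (Function.uncurry G) (volume.prod μ) := by
    refine ((integrable_callKernel hα).norm.mul_prod hint).mono' ?_ (.of_forall fun p => ?_)
    · have := (continuous_callKernel hα).measurable
      have hm : Measurable (Function.uncurry G) := by
        simp only [G, Function.uncurry_def]
        fun_prop
      exact hm.aestronglyMeasurable
    · simp only [Function.uncurry_def, hGeq, norm_mul, Complex.norm_exp_ofReal_mul_I, one_mul,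
        Complex.norm_real, Real.norm_eq_abs, Real.abs_exp]
      rw [mul_comm]
  have hinner : (fun v : ℝ => Complex.exp (-((v * c : ℝ) : ℂ) * Complex.I) *
      (∫ ω, Complex.exp (((α : ℂ) + 1 + (v : ℂ) * Complex.I) * (Y ω : ℂ)) ∂μ) /
        (((α : ℂ) + (v : ℂ) * Complex.I) * (1 + (α : ℂ) + (v : ℂ) * Complex.I))) =
      fun v => ∫ ω, G v ω ∂μ := by
    ext v
    simp only [G]
    rw [integral_mul_const, integral_const_mul, callKernel, div_eq_mul_inv]
  have hint' : Integrable (fun v => ∫ ω, G v ω ∂μ) := hG.integral_prod_left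
  have hprice : ∫ v, ∫ ω, G v ω ∂μ =
      ((2 * Real.pi * Real.exp (α * c) * ∫ ω, max (Real.exp (Y ω) - K) 0 ∂μ : ℝ) : ℂ) := by
    rw [integral_integral_swap hG, ← integral_const_mul, ← integral_complex_ofReal]
    congr 1
    ext ω
    simp only [hGeq]
    rw [integral_const_mul, integral_exp_mul_callKernel hα, mul_assoc (2 * Real.pi),
      ← exp_mul_dampedCall hK]
    push_cast
    ring
  refine ⟨hinner ▸ hint', ?_⟩
  simp only [fun v => congrFun hinner v]
  have hre : ∫ v, (∫ ω, G v ω ∂μ).re = (∫ v, ∫ ω, G v ω ∂μ).re := integral_re hint'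
  rw [hre, hprice, Complex.ofReal_re, neg_mul, Real.exp_neg]
  field_simp
end
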